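/- arXiv:2408.12964 — 3 statements merged into one kernel-verified Lean document; each statement's English description precedes it below -/
import Mathlib

section
/- Let α₁ : ℝ → ℝ be an extended class K_e function and let α₂ : [0,∞) → ℝ be a convex class K function such that α₁(-x) ≤ -α₂(x) for all x ∈ [0, A], where A > 0 is finite. Then there exists an extended class K_e function β : ℝ → ℝ such that for all x₁ ∈ [-A, ∞) and all x₂ ∈ [0, A], α₁(x₁) + α₂(x₂) ≤ β(x₁ + x₂). -/
theorem incr_aux (f : ℝ → ℝ) (hf : ConvexOn ℝ (Set.Ici 0) f) (a b h : ℝ) (ha : 0 ≤ a)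
    (hab : a ≤ b) (hh : 0 ≤ h) : f (a + h) + f b ≤ f a + f (b + h) := by
  rcases eq_or_lt_of_le (show a ≤ b + h by linarith) with e | hL
  · have h0 : h = 0 := by linarith
    have h1 : b = a := by linarith
    subst h0; subst h1; simp
  · have hL' : 0 < b + h - a := by linarith
    have hl0 : 0 ≤ h / (b + h - a) := by positivity
    have hl1 : 0 ≤ 1 - h / (b + h - a) := by
      rw [sub_nonneg, div_le_one hL']; linarith
    have ha' : a ∈ Set.Ici (0:ℝ) := ha
    have hb' : b + h ∈ Set.Ici (0:ℝ) := by simp only [Set.mem_Ici]; linarith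
    have e1 := hf.2 ha' hb' hl1 hl0 (by ring)
    have e2 := hf.2 ha' hb' hl0 hl1 (by ring)
    have hk : h / (b + h - a) * (b + h - a) = h := by field_simp
    simp only [smul_eq_mul] at e1 e2
    generalize h / (b + h - a) = l at *
    rw [show (1 - l) * a + l * (b + h) = a + h by linarith] at e1
    rw [show l * a + (1 - l) * (b + h) = b by linarith] at e2
    linarith

/-- Lemma 2: If `α₁` is an extended class `K_e` function and `α₂`
is a convex class `K` function (on `[0,∞)`) with `α₁ (-x) ≤ -α₂ x` for all
`x ∈ [0, A]`, `A > 0`, then there exists an extended class `K_e` function `β`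
with `α₁ x₁ + α₂ x₂ ≤ β (x₁ + x₂)` for all `x₁ ∈ [-A, ∞)`, `x₂ ∈ [0, A]`. -/
theorem stmt_2
    (α₁ : ℝ → ℝ) (hα₁cont : Continuous α₁) (hα₁mono : StrictMono α₁) (hα₁0 : α₁ 0 = 0)
    (α₂ : ℝ → ℝ) (hα₂cont : ContinuousOn α₂ (Set.Ici 0))
    (hα₂mono : StrictMonoOn α₂ (Set.Ici 0)) (hα₂0 : α₂ 0 = 0)
    (hα₂convex : ConvexOn ℝ (Set.Ici 0) α₂)
    (A : ℝ) (hA : 0 < A)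
    (hcomp : ∀ x ∈ Set.Icc 0 A, α₁ (-x) ≤ -α₂ x) :
    ∃ β : ℝ → ℝ, Continuous β ∧ StrictMono β ∧ β 0 = 0 ∧
      ∀ x₁ ∈ Set.Ici (-A), ∀ x₂ ∈ Set.Icc 0 A, α₁ x₁ + α₂ x₂ ≤ β (x₁ + x₂) := by
  have hm : ∀ x y, 0 ≤ x → x ≤ y → α₂ x ≤ α₂ y := fun x y hx hxy =>
    hα₂mono.monotoneOn (show x ∈ Set.Ici (0:ℝ) from hx)
      (show y ∈ Set.Ici (0:ℝ) from hx.trans hxy) hxy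
  have hs : ∀ x y, 0 ≤ x → x < y → α₂ x < α₂ y := fun x y hx hxy =>
    hα₂mono (show x ∈ Set.Ici (0:ℝ) from hx)
      (show y ∈ Set.Ici (0:ℝ) from hx.trans hxy.le) hxy
  obtain ⟨g, hg⟩ : ∃ g : ℝ → ℝ, g = fun x => α₂ (max x 0) := ⟨_, rfl⟩
  have gp : ∀ x, 0 ≤ x → g x = α₂ x := fun x hx => by simp [hg, max_eq_left hx]
  have gn : ∀ x, x ≤ 0 → g x = 0 := fun x hx => by simp [hg, max_eq_right hx, hα₂0]
  have gc : Continuous g := by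
    rw [hg]
    exact hα₂cont.comp_continuous (by fun_prop) (fun x => le_max_right x 0)
  have gm : Monotone g := by
    intro x y hxy
    rw [hg]
    exact hm _ _ (le_max_right _ _) (max_le_max_right 0 hxy)
  refine ⟨fun s => α₁ (max s 0) + g s - g (-s) + g A - g (min A (A - s)), by fun_prop, ?_, ?_, ?_⟩
  · intro x y hxy
    have h1 : α₁ (max x 0) ≤ α₁ (max y 0) := hα₁mono.monotone (max_le_max_right 0 hxy.le)
    have h2 : g (min A (A - y)) ≤ g (min A (A - x)) :=
      gm (min_le_min_left A (by linarith))
    have h3 : g x - g (-x) < g y - g (-y) := by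
      have k1 := gm hxy.le
      have k2 := gm (neg_le_neg hxy.le)
      rcases le_or_gt 0 x with h | h
      · have := hs x y h hxy
        rw [← gp x h, ← gp y (h.trans hxy.le)] at this
        linarith
      · have : g (-y) < g (-x) := by
          rcases le_or_gt y 0 with h' | h'
          · rw [gp _ (by linarith), gp _ (by linarith)]
            exact hs _ _ (by linarith) (by linarith)
          · rw [gn (-y) (by linarith), gp _ (by linarith), ← hα₂0]
            exact hs _ _ le_rfl (by linarith)
        linarith
    dsimp only
    linarith
  · simp [hα₁0, gn 0 le_rfl]
  · intro x₁ hx₁ x₂ hx₂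
    obtain ⟨h20, h2A⟩ := hx₂
    have hx₁' : -A ≤ x₁ := hx₁
    dsimp only
    rcases le_or_gt 0 (x₁ + x₂) with h | h
    · rw [max_eq_left h, gp _ h, gn (-(x₁ + x₂)) (by linarith),
        min_eq_right (by linarith : A - (x₁ + x₂) ≤ A)]
      have hα : 0 ≤ α₁ (x₁ + x₂) := by rw [← hα₁0]; exact hα₁mono.monotone h
      have hβ : 0 ≤ α₂ (x₁ + x₂) := by rw [← hα₂0]; exact hm _ _ le_rfl h
      rcases le_or_gt 0 x₁ with h1 | h1
      · have a1 : α₁ x₁ ≤ α₁ (x₁ + x₂) := hα₁mono.monotone (by linarith)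
        have a2 := hm x₂ (x₁ + x₂) h20 (by linarith)
        have a3 := gm (show A - (x₁ + x₂) ≤ A by linarith)
        linarith
      · have c := hcomp (-x₁) ⟨by linarith, by linarith⟩
        rw [neg_neg] at c
        have d := incr_aux α₂ hα₂convex (-x₁) (A - (x₁ + x₂)) (x₁ + x₂) (by linarith)
          (by linarith) h
        rw [show -x₁ + (x₁ + x₂) = x₂ by ring,
          show A - (x₁ + x₂) + (x₁ + x₂) = A by ring] at d
        rw [gp A hA.le, gp _ (by linarith)]
        linarith
    · rw [max_eq_right h.le, gn _ h.le, gp (-(x₁ + x₂)) (by linarith),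
        min_eq_left (by linarith : A ≤ A - (x₁ + x₂)), hα₁0]
      have c := hcomp (-x₁) ⟨by linarith, by linarith⟩
      rw [neg_neg] at c
      have d := incr_aux α₂ hα₂convex 0 x₂ (-(x₁ + x₂)) le_rfl h20 (by linarith)
      rw [zero_add, hα₂0, show x₂ + -(x₁ + x₂) = -x₁ by ring] at d
      linarith
end

section
/- Let α₁ : ℝ → ℝ be an extended class K_e function and let α₂ : [0,∞) → ℝ be a concave class K function such that α₁(-x) ≤ -α₂(x) for all x ∈ [0, A], where A > 0 is finite. Then there exists an extended class K_e function β : ℝ → ℝ such that for all x₁ ∈ [-A, ∞) and all x₂ ∈ [0, A], α₁(x₁) + α₂(x₂) ≤ β(x₁ + x₂). -/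
lemma aux_conc (f : ℝ → ℝ) (hf : ConcaveOn ℝ (Set.Ici 0) f) (x y d : ℝ)
    (hx : 0 ≤ x) (hxy : x ≤ y) (hd : 0 ≤ d) : f (y + d) + f x ≤ f (x + d) + f y := by
  rcases hd.eq_or_lt with h | h
  · subst h; simp [add_comm]
  have hL : 0 < y + d - x := by linarith
  have hu : 0 ≤ (y - x) / (y + d - x) := div_nonneg (by linarith) hL.le
  have hv : 0 ≤ d / (y + d - x) := div_nonneg hd hL.le
  have huv : (y - x) / (y + d - x) + d / (y + d - x) = 1 := by field_simp; ring
  have mx : x ∈ Set.Ici (0 : ℝ) := hx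
  have my : y + d ∈ Set.Ici (0 : ℝ) := by simp only [Set.mem_Ici]; linarith
  have h1 := hf.2 mx my hu hv huv
  have h2 := hf.2 mx my hv hu (by linarith)
  simp only [smul_eq_mul] at h1 h2
  have e1 : (y - x) / (y + d - x) * x + d / (y + d - x) * (y + d) = x + d := by field_simp; ring
  have e2 : d / (y + d - x) * x + (y - x) / (y + d - x) * (y + d) = y := by field_simp; ring
  rw [e1] at h1
  rw [e2] at h2
  generalize (y - x) / (y + d - x) = u at *
  generalize d / (y + d - x) = v at *
  have hv' : v = 1 - u := by linarith
  subst hv'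
  nlinarith


/-- Lemma 3: If `α₁` is an extended class `K_e` function and `α₂`
is a concave class `K` function (on `[0,∞)`) with `α₁ (-x) ≤ -α₂ x` for all
`x ∈ [0, A]`, `A > 0`, then there exists an extended class `K_e` function `β`
with `α₁ x₁ + α₂ x₂ ≤ β (x₁ + x₂)` for all `x₁ ∈ [-A, ∞)`, `x₂ ∈ [0, A]`. -/
theorem stmt_3
    (α₁ : ℝ → ℝ) (hα₁cont : Continuous α₁) (hα₁mono : StrictMono α₁) (hα₁0 : α₁ 0 = 0)
    (α₂ : ℝ → ℝ) (hα₂cont : ContinuousOn α₂ (Set.Ici 0))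
    (hα₂mono : StrictMonoOn α₂ (Set.Ici 0)) (hα₂0 : α₂ 0 = 0)
    (hα₂concave : ConcaveOn ℝ (Set.Ici 0) α₂)
    (A : ℝ) (hA : 0 < A)
    (hcomp : ∀ x ∈ Set.Icc 0 A, α₁ (-x) ≤ -α₂ x) :
    ∃ β : ℝ → ℝ, Continuous β ∧ StrictMono β ∧ β 0 = 0 ∧
      ∀ x₁ ∈ Set.Ici (-A), ∀ x₂ ∈ Set.Icc 0 A, α₁ x₁ + α₂ x₂ ≤ β (x₁ + x₂) := by
  have hmono := hα₂mono.monotoneOn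
  have hc : Continuous fun x : ℝ => α₂ (max x 0) :=
    hα₂cont.comp_continuous (by fun_prop) (fun x => le_max_right x 0)
  have hm : Monotone fun x : ℝ => α₂ (max x 0) := fun a b hab =>
    hmono (le_max_right a 0) (le_max_right b 0) (max_le_max_right 0 hab)
  obtain ⟨g, hg⟩ : ∃ g : ℝ → ℝ, g = fun x => α₂ (max x 0) + min x 0 := ⟨_, rfl⟩
  have gc : Continuous g := by rw [hg]; exact hc.add (by fun_prop)
  have gpos : ∀ x, 0 ≤ x → g x = α₂ x := fun x hx => by simp [hg, hx]
  have gm : StrictMono g := by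
    intro a b hab
    rcases le_or_gt 0 a with h | h
    · rw [gpos a h, gpos b (h.trans hab.le)]
      exact hα₂mono h (h.trans hab.le) hab
    · have h1 := hm hab.le
      have h2 : min a 0 < min b 0 := by
        rw [min_eq_left h.le]; exact lt_min hab h
      simp only [hg] at h1 ⊢
      linarith
  refine ⟨fun s => α₁ (max s 0) + α₂ (max s 0) + (g (A + min s 0) - g A), ?_, ?_, ?_, ?_⟩
  · exact ((hα₁cont.comp (by fun_prop)).add hc).add ((gc.comp (by fun_prop)).sub continuous_const)
  · intro a b hab
    have h1 := hm hab.le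
    have h2 : α₁ (max a 0) ≤ α₁ (max b 0) := hα₁mono.monotone (max_le_max_right 0 hab.le)
    have h3 : g (A + min a 0) ≤ g (A + min b 0) :=
      gm.monotone (by linarith [min_le_min_right 0 hab.le])
    simp only at h1 ⊢
    rcases le_or_gt b 0 with h | h
    · have : g (A + min a 0) < g (A + min b 0) := gm (by
        rw [min_eq_left h, min_eq_left (hab.le.trans h)]; linarith)
      linarith
    · have : α₁ (max a 0) < α₁ (max b 0) := hα₁mono (by
        rw [max_eq_left h.le]; exact max_lt hab h)
      linarith
  · simp [hα₁0, hα₂0]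
  · intro x₁ h1 x₂ ⟨h2, h2A⟩
    simp only [Set.mem_Ici] at h1
    simp only
    rcases le_or_gt 0 x₁ with h | h
    · have hs : 0 ≤ x₁ + x₂ := by linarith
      have i1 : α₁ x₁ ≤ α₁ (x₁ + x₂) := hα₁mono.monotone (by linarith)
      have i2 : α₂ x₂ ≤ α₂ (x₁ + x₂) := hmono h2 hs (by linarith)
      simp only [max_eq_left hs, min_eq_right hs, add_zero]
      linarith
    · have i0 := hcomp (-x₁) ⟨by linarith, by linarith⟩
      rw [neg_neg] at i0
      rcases le_or_gt 0 (x₁ + x₂) with hs | hs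
      · have i1 : 0 ≤ α₁ (x₁ + x₂) := hα₁0 ▸ hα₁mono.monotone hs
        have i2 := aux_conc α₂ hα₂concave 0 (-x₁) (x₁ + x₂) le_rfl (by linarith) hs
        rw [show -x₁ + (x₁ + x₂) = x₂ by ring, zero_add] at i2
        simp only [max_eq_left hs, min_eq_right hs, add_zero]
        linarith
      · have i2 := aux_conc α₂ hα₂concave x₂ (A + (x₁ + x₂)) (-(x₁ + x₂)) h2
          (by linarith) (by linarith)
        rw [show A + (x₁ + x₂) + -(x₁ + x₂) = A by ring,
          show x₂ + -(x₁ + x₂) = -x₁ by ring] at i2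
        rw [max_eq_right hs.le, min_eq_left hs.le, gpos A hA.le, gpos _ (by linarith), hα₁0, hα₂0]
        linarith
end

section
/- Let β : ℝ → ℝ be an extended class K_e function which is locally Lipschitz. Let y : [0,∞) → ℝ be differentiable with y'(t) ≥ -β(y(t)) for all t ≥ 0, and suppose y(0) ≥ 0. Then y(t) ≥ 0 for all t ≥ 0. -/
/-- comparison lemma: If `β` is a locally Lipschitz extended
class `K_e` function and `y : [0,∞) → ℝ` is differentiable with
`y'(t) ≥ -β (y t)` for all `t ≥ 0` and `y 0 ≥ 0`, then `y t ≥ 0` for all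
`t ≥ 0`. -/
theorem stmt_7
    (β : ℝ → ℝ) (hβcont : Continuous β) (hβmono : StrictMono β) (hβ0 : β 0 = 0)
    (hβlip : LocallyLipschitz β)
    (y y' : ℝ → ℝ) (hy : ∀ t ≥ (0:ℝ), HasDerivAt y (y' t) t)
    (hineq : ∀ t ≥ (0:ℝ), y' t ≥ -β (y t))
    (h0 : y 0 ≥ 0) :
    ∀ t ≥ (0:ℝ), y t ≥ 0 := by
  intro t ht
  by_contra hneg
  have hpos : 0 < -y t / 2 := by
    have := not_le.mp hneg
    linarith
  have key := image_le_of_deriv_right_lt_deriv_boundary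
    (f := fun s => -y s) (f' := fun s => -y' s) (a := 0) (b := t)
    (B := fun _ => -y t / 2) (B' := fun _ => 0)
    (fun s hs => ((hy s hs.1).neg.continuousAt).continuousWithinAt)
    (fun s hs => (hy s hs.1).neg.hasDerivWithinAt)
    (by show -y 0 ≤ -y t / 2; linarith) (fun s => hasDerivAt_const s _)
    (fun s hs h => by
      have h1 : y s < 0 := by
        have h2 : -y s = -y t / 2 := h
        linarith
      have h3 := hβmono h1
      have h4 := hineq s hs.1
      show -y' s < 0
      linarith)
    (show t ∈ Set.Icc 0 t from ⟨ht, le_refl t⟩)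
  have key' : -y t ≤ -y t / 2 := key
  linarith
end
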